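/- Let C be a skeletally small triangulated category. For a Q-subspace H of G(C)_Q let D_H denote the unique radical dense subcategory of C with image(δ^{D_H}_Q) = H. Then for Q-subspaces H₁, H₂ of G(C)_Q one has D_{H₁} ⊆ D_{H₂} if and only if H₁ ⊆ H₂. -/

import Mathlib

open CategoryTheory CategoryTheory.Limits CategoryTheory.Pretriangulated
open scoped TensorProduct

universe v u

set_option linter.unusedSectionVars false
set_option linter.unusedVariables false

namespace GrothendieckPaper

variable (C : Type u) [Category.{v} C] [Preadditive C] [Limits.HasZeroObject C]
  [HasShift C ℤ] [∀ n : ℤ, (shiftFunctor C n).Additive] [Pretriangulated C]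

/-- The set of Euler relations `[V] - [U] - [W]` coming from distinguished triangles
`U ⟶ V ⟶ W ⟶ U⟦1⟧`. -/
def eulerSet : Set (FreeAbelianGroup C) :=
  { x | ∃ T : Triangle C, (T ∈ distTriang C) ∧
      x = FreeAbelianGroup.of T.obj₂ - FreeAbelianGroup.of T.obj₁ - FreeAbelianGroup.of T.obj₃ }

def eulerSubgroup : AddSubgroup (FreeAbelianGroup C) := AddSubgroup.closure (eulerSet C)

/-- The Grothendieck group of a (skeletally small) triangulated category. -/
def G : Type u := FreeAbelianGroup C ⧸ eulerSubgroup C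

instance : AddCommGroup (G C) := QuotientAddGroup.Quotient.addCommGroup _

/-- The class `[U]` of an object `U` in the Grothendieck group. -/
def cls (U : C) : G C := QuotientAddGroup.mk (FreeAbelianGroup.of U)

/-- A (strictly full) triangulated subcategory of `C`, given by its set of objects:
closed under isomorphisms, under the shifts `[1]` and `[-1]`, and under extensions
(cones): if `X ⟶ Y ⟶ Z ⟶ X⟦1⟧` is distinguished and `X, Y` belong then so does `Z`. -/
structure IsTriangulatedSubcat (S : Set C) : Prop where
  mem_of_iso : ∀ {X Y : C}, (X ≅ Y) → Y ∈ S → X ∈ S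
  shift_mem : ∀ {X : C}, X ∈ S → ((shiftFunctor C (1 : ℤ)).obj X) ∈ S
  shift_neg_mem : ∀ {X : C}, X ∈ S → ((shiftFunctor C (-1 : ℤ)).obj X) ∈ S
  ext_mem : ∀ (T : Triangle C), (T ∈ distTriang C) → T.obj₁ ∈ S → T.obj₂ ∈ S → T.obj₃ ∈ S

/-- `npowAux U n` is the direct sum of `n + 1` copies of `U`. -/
noncomputable def npowAux (U : C) : ℕ → C
  | 0 => U
  | n + 1 => U ⊞ npowAux U n

/-- `npow U n` is the direct sum `U^n` of `n` copies of `U` (for `n ≥ 1`;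
`npow U 0` is defined to be `U` as a junk value). -/
noncomputable def npow (U : C) (n : ℕ) : C := npowAux C U (n - 1)

/-- A subcategory (set of objects) `S` is dense in `C` if every object of `C` is a
direct summand of an object of `S`. -/
def DenseSub (S : Set C) : Prop := ∀ U : C, ∃ V : C, (U ⊞ V) ∈ S

/-- A subcategory `S` is radical if `U^n ∈ S` for some `n ≥ 1` implies `U ∈ S`. -/
def RadicalSub (S : Set C) : Prop := ∀ (U : C) (n : ℕ), 1 ≤ n → npow C U n ∈ S → U ∈ S

/-- `√S = { U | U^n ∈ S for some n ≥ 1 }`. -/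
def sqrtSet (S : Set C) : Set C := { U : C | ∃ n : ℕ, 1 ≤ n ∧ npow C U n ∈ S }

lemma subset_sqrtSet (S : Set C) : S ⊆ sqrtSet C S := fun U hU => ⟨1, le_refl 1, hU⟩

/-- The Euler relations for the full subcategory on `S`, coming from distinguished
triangles of `C` all of whose vertices lie in `S`. -/
def eulerSetSub (S : Set C) : Set (FreeAbelianGroup S) :=
  { x | ∃ (T : Triangle C) (_ : T ∈ distTriang C) (h1 : T.obj₁ ∈ S) (h2 : T.obj₂ ∈ S)
      (h3 : T.obj₃ ∈ S),
      x = FreeAbelianGroup.of (⟨T.obj₂, h2⟩ : S) - FreeAbelianGroup.of ⟨T.obj₁, h1⟩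
        - FreeAbelianGroup.of ⟨T.obj₃, h3⟩ }

/-- The Grothendieck group of the triangulated subcategory on the set of objects `S`. -/
def GSub (S : Set C) : Type u := FreeAbelianGroup S ⧸ AddSubgroup.closure (eulerSetSub C S)

instance (S : Set C) : AddCommGroup (GSub C S) := QuotientAddGroup.Quotient.addCommGroup _

lemma delta_le (S : Set C) :
    AddSubgroup.closure (eulerSetSub C S) ≤
      (eulerSubgroup C).comap (FreeAbelianGroup.map (Subtype.val : S → C)) := by
  rw [AddSubgroup.closure_le]
  rintro x ⟨T, hT, h1, h2, h3, rfl⟩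
  simp only [SetLike.mem_coe, AddSubgroup.mem_comap, map_sub, FreeAbelianGroup.map_of_apply]
  exact AddSubgroup.subset_closure ⟨T, hT, rfl⟩

/-- The natural map `δ^S : G(S) → G(C)` induced by the inclusion of the subcategory. -/
def deltaHom (S : Set C) : GSub C S →+ G C :=
  QuotientAddGroup.map _ _ (FreeAbelianGroup.map (Subtype.val : S → C)) (delta_le C S)

lemma incl_le {S S' : Set C} (h : S ⊆ S') :
    AddSubgroup.closure (eulerSetSub C S) ≤
      (AddSubgroup.closure (eulerSetSub C S')).comap
        (FreeAbelianGroup.map (Set.inclusion h)) := by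
  rw [AddSubgroup.closure_le]
  rintro x ⟨T, hT, h1, h2, h3, rfl⟩
  simp only [SetLike.mem_coe, AddSubgroup.mem_comap, map_sub, FreeAbelianGroup.map_of_apply]
  exact AddSubgroup.subset_closure ⟨T, hT, h h1, h h2, h h3, rfl⟩

/-- The map `G(S) → G(S')` induced by an inclusion `S ⊆ S'` of subcategories. -/
def inclHom {S S' : Set C} (h : S ⊆ S') : GSub C S →+ GSub C S' :=
  QuotientAddGroup.map _ _ (FreeAbelianGroup.map (Set.inclusion h)) (incl_le C h)

/-- `δ^S ⊗ ℚ : G(S)_ℚ → G(C)_ℚ`. -/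
noncomputable def deltaQ (S : Set C) : ℚ ⊗[ℤ] GSub C S →ₗ[ℚ] ℚ ⊗[ℤ] G C :=
  LinearMap.baseChange ℚ (deltaHom C S).toIntLinearMap

/-- The rationalization of the map induced by an inclusion of subcategories. -/
noncomputable def inclQ {S S' : Set C} (h : S ⊆ S') :
    ℚ ⊗[ℤ] GSub C S →ₗ[ℚ] ℚ ⊗[ℤ] GSub C S' :=
  LinearMap.baseChange ℚ (inclHom C h).toIntLinearMap

/-- The collection `I(H)` of dense triangulated subcategories `S` of `C` with
`image(δ^S_ℚ) = H`. -/
def denseFamily (H : Submodule ℚ (ℚ ⊗[ℤ] G C)) : Set (Set C) :=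
  { S | IsTriangulatedSubcat C S ∧ DenseSub C S ∧ LinearMap.range (deltaQ C S) = H }

section

open scoped ZeroObject

/-- The isomorphism classes of objects of `C`, a commutative monoid under direct sum. -/
def IsoClass : Type u := Quotient (isIsomorphicSetoid C)

variable {C}

/-- The isomorphism class of an object. -/
def isoClass (X : C) : IsoClass C := Quotient.mk (isIsomorphicSetoid C) X

lemma isoClass_eq_iff {X Y : C} : isoClass X = isoClass Y ↔ Nonempty (X ≅ Y) := Quotient.eq

lemma isoClass_eq {X Y : C} (e : X ≅ Y) : isoClass X = isoClass Y := isoClass_eq_iff.2 ⟨e⟩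

lemma exists_isoClass_eq (m : IsoClass C) : ∃ X : C, isoClass X = m := Quotient.exists_rep m

noncomputable instance : Add (IsoClass C) where
  add := Quotient.map₂ (fun X Y : C => X ⊞ Y)
    fun _ _ ⟨e⟩ _ _ ⟨e'⟩ => ⟨biprod.mapIso e e'⟩

noncomputable instance : Zero (IsoClass C) := ⟨isoClass 0⟩

lemma isoClass_biprod (X Y : C) : isoClass (X ⊞ Y) = isoClass X + isoClass Y := rfl

lemma isoClass_of_isZero {X : C} (hX : IsZero X) : isoClass X = 0 := isoClass_eq hX.isoZero

noncomputable instance : AddCommMonoid (IsoClass C) :=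
  have comm (a b : IsoClass C) : a + b = b + a := by
    obtain ⟨X, rfl⟩ := exists_isoClass_eq a
    obtain ⟨Y, rfl⟩ := exists_isoClass_eq b
    exact isoClass_eq (biprod.braiding X Y)
  have add_zero (a : IsoClass C) : a + 0 = a := by
    obtain ⟨X, rfl⟩ := exists_isoClass_eq a
    exact (isoClass_eq (isoBiprodZero (isZero_zero C))).symm
  { add_assoc := fun a b c => by
      obtain ⟨X, rfl⟩ := exists_isoClass_eq a
      obtain ⟨Y, rfl⟩ := exists_isoClass_eq b
      obtain ⟨Z, rfl⟩ := exists_isoClass_eq c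
      exact isoClass_eq (biprod.associator X Y Z)
    zero_add := fun a => by rw [comm, add_zero]
    add_zero := add_zero
    add_comm := comm
    nsmul := nsmulRec }

lemma isoClass_prod (F : WalkingPair → C) :
    isoClass (∏ᶜ F) = isoClass (F .left) + isoClass (F .right) :=
  isoClass_eq (HasLimit.isoOfNatIso (diagramIsoPair (Discrete.functor F)) ≪≫
    (biprod.isoProd (F .left) (F .right)).symm)

/-- A direct sum of two distinguished triangles is distinguished. -/
lemma exists_distinguished_add {T T' : Triangle C} (hT : T ∈ distTriang C)
    (hT' : T' ∈ distTriang C) :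
    ∃ T'' ∈ distTriang C, isoClass T''.obj₁ = isoClass T.obj₁ + isoClass T'.obj₁ ∧
      isoClass T''.obj₂ = isoClass T.obj₂ + isoClass T'.obj₂ ∧
      isoClass T''.obj₃ = isoClass T.obj₃ + isoClass T'.obj₃ := by
  let F : WalkingPair → Triangle C := fun j => WalkingPair.casesOn j T T'
  exact ⟨productTriangle F, productTriangle_distinguished F (by rintro (_ | _) <;> assumption),
    isoClass_prod fun j => (F j).obj₁, isoClass_prod fun j => (F j).obj₂,
    isoClass_prod fun j => (F j).obj₃⟩

lemma IsTriangulatedSubcat.mem_obj₂ {S : Set C} (h : IsTriangulatedSubcat C S) (T : Triangle C)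
    (hT : T ∈ distTriang C) (h₁ : T.obj₁ ∈ S) (h₃ : T.obj₃ ∈ S) : T.obj₂ ∈ S :=
  h.ext_mem T.invRotate (inv_rot_of_distTriang T hT) (h.shift_neg_mem h₃) h₁

lemma DenseSub.zero_mem {S : Set C} (hd : DenseSub C S) (h : IsTriangulatedSubcat C S) :
    (0 : C) ∈ S := by
  obtain ⟨V, hV⟩ := hd 0
  exact h.ext_mem _ (contractible_distinguished (0 ⊞ V)) hV hV

/-- The submonoid of isomorphism classes of objects of a dense triangulated subcategory. -/
def isoClassSubmonoid {S : Set C} (h : IsTriangulatedSubcat C S) (hd : DenseSub C S) :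
    AddSubmonoid (IsoClass C) where
  carrier := isoClass '' S
  zero_mem' := ⟨0, hd.zero_mem h, rfl⟩
  add_mem' := by
    rintro _ _ ⟨X, hX, rfl⟩ ⟨Y, hY, rfl⟩
    exact ⟨X ⊞ Y, h.mem_obj₂ _ (binaryBiproductTriangle_distinguished X Y) hX hY, rfl⟩

section

variable {S : Set C} (h : IsTriangulatedSubcat C S) (hd : DenseSub C S)

lemma isoClass_mem_iff {X : C} : isoClass X ∈ isoClassSubmonoid h hd ↔ X ∈ S := by
  refine ⟨?_, fun hX => ⟨X, hX, rfl⟩⟩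
  rintro ⟨Y, hY, e⟩
  obtain ⟨e⟩ := isoClass_eq_iff.1 e
  exact h.mem_of_iso e.symm hY

lemma mem_of_add_mem_isoClassSubmonoid {a b : IsoClass C} (ha : a ∈ isoClassSubmonoid h hd)
    (hab : a + b ∈ isoClassSubmonoid h hd) : b ∈ isoClassSubmonoid h hd := by
  obtain ⟨X, rfl⟩ := exists_isoClass_eq a
  obtain ⟨Y, rfl⟩ := exists_isoClass_eq b
  rw [← isoClass_biprod] at hab
  rw [isoClass_mem_iff] at ha hab ⊢
  exact h.ext_mem _ (binaryBiproductTriangle_distinguished X Y) ha hab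

lemma exists_add_mem_isoClassSubmonoid (a : IsoClass C) :
    ∃ b, a + b ∈ isoClassSubmonoid h hd := by
  obtain ⟨X, rfl⟩ := exists_isoClass_eq a
  obtain ⟨V, hV⟩ := hd X
  exact ⟨isoClass V, X ⊞ V, hV, rfl⟩

lemma add_mem_isoClassSubmonoid_of_distinguished (T : Triangle C) (hT : T ∈ distTriang C)
    {a b : IsoClass C} (ha : isoClass T.obj₁ + a ∈ isoClassSubmonoid h hd)
    (hb : isoClass T.obj₃ + b ∈ isoClassSubmonoid h hd) :
    isoClass T.obj₂ + a + b ∈ isoClassSubmonoid h hd := by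
  obtain ⟨X, rfl⟩ := exists_isoClass_eq a
  obtain ⟨Y, rfl⟩ := exists_isoClass_eq b
  obtain ⟨T₁, hT₁, e₁, e₂, e₃⟩ := exists_distinguished_add hT (contractible_distinguished X)
  obtain ⟨T₂, hT₂, f₁, f₂, f₃⟩ := exists_distinguished_add hT₁ (contractible_distinguished₁ Y)
  simp only [contractibleTriangle_obj₁, contractibleTriangle_obj₂, contractibleTriangle_obj₃,
    Triangle.mk_obj₁, Triangle.mk_obj₂, Triangle.mk_obj₃, isoClass_of_isZero (isZero_zero C), add_zero] at e₁ e₂ e₃ f₁ f₂ f₃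
  rw [e₁] at f₁
  rw [e₂] at f₂
  rw [e₃] at f₃
  rw [← f₁, isoClass_mem_iff] at ha
  rw [← f₃, isoClass_mem_iff] at hb
  rw [← f₂, isoClass_mem_iff]
  exact h.mem_obj₂ T₂ hT₂ ha hb

end

/-- An additive submonoid closed under subtraction and cofinal in `M` is the preimage of the
subgroup it generates in the Grothendieck group of `M`. -/
lemma mem_of_of_mem_closure {M : Type*} [AddCommMonoid M] (N : AddSubmonoid M)
    (hN : ∀ {a b}, a ∈ N → a + b ∈ N → b ∈ N) (hcof : ∀ a, ∃ b, a + b ∈ N) {m : M}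
    (hm : Algebra.GrothendieckAddGroup.of m ∈
      AddSubgroup.closure (Algebra.GrothendieckAddGroup.of '' (N : Set M))) : m ∈ N := by
  have key : ∀ x ∈ AddSubgroup.closure (Algebra.GrothendieckAddGroup.of '' (N : Set M)),
      ∃ a ∈ N, ∃ b ∈ N, x + Algebra.GrothendieckAddGroup.of b =
        Algebra.GrothendieckAddGroup.of a := by
    intro x hx
    induction hx using AddSubgroup.closure_induction with
    | mem x hx =>
      obtain ⟨a, ha, rfl⟩ := hx
      exact ⟨a, ha, 0, N.zero_mem, by simp⟩
    | zero => exact ⟨0, N.zero_mem, 0, N.zero_mem, by simp⟩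
    | add x y _ _ hx hy =>
      obtain ⟨a, ha, b, hb, e⟩ := hx
      obtain ⟨a', ha', b', hb', e'⟩ := hy
      refine ⟨a + a', N.add_mem ha ha', b + b', N.add_mem hb hb', ?_⟩
      rw [map_add, map_add, ← e, ← e']
      abel
    | neg x _ hx =>
      obtain ⟨a, ha, b, hb, e⟩ := hx
      exact ⟨b, hb, a, ha, by rw [← e]; abel⟩
  obtain ⟨a, ha, b, hb, e⟩ := key _ hm
  rw [← map_add] at e
  obtain ⟨⟨c, _⟩, hc⟩ := (AddLocalization.addMonoidOf (⊤ : AddSubmonoid M)).eq_iff_exists.1 e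
  obtain ⟨d, hd⟩ := hcof c
  have hc : c + (m + b) = c + a := hc
  refine hN (N.add_mem hd hb) ?_
  have : c + d + b + m = a + (c + d) := by
    calc c + d + b + m = c + (m + b) + d := by abel
      _ = a + (c + d) := by rw [hc]; abel
  rw [this]
  exact N.add_mem ha hd

/-- **Thomason's theorem**: an object whose class comes from the Grothendieck group of a dense
triangulated subcategory belongs to this subcategory. -/
theorem mem_of_cls_mem_range {S : Set C} (h : IsTriangulatedSubcat C S) (hd : DenseSub C S)
    {X : C} (hX : cls C X ∈ (deltaHom C S).range) : X ∈ S := by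
  let of := Algebra.GrothendieckAddGroup.of (M := IsoClass C)
  let N := isoClassSubmonoid h hd
  let H := AddSubgroup.closure (of '' (N : Set (IsoClass C)))
  let Φ : FreeAbelianGroup C →+ Algebra.GrothendieckAddGroup (IsoClass C) :=
    FreeAbelianGroup.lift fun Y => of (isoClass Y)
  have of_mem {a : IsoClass C} (ha : a ∈ N) : of a ∈ H :=
    AddSubgroup.subset_closure ⟨a, ha, rfl⟩
  have euler : eulerSubgroup C ≤ H.comap Φ := by
    rw [eulerSubgroup, AddSubgroup.closure_le]
    rintro _ ⟨T, hT, rfl⟩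
    obtain ⟨a, ha⟩ := exists_add_mem_isoClassSubmonoid h hd (isoClass T.obj₁)
    obtain ⟨b, hb⟩ := exists_add_mem_isoClassSubmonoid h hd (isoClass T.obj₃)
    have := H.sub_mem (H.sub_mem
      (of_mem (add_mem_isoClassSubmonoid_of_distinguished h hd T hT ha hb)) (of_mem ha))
      (of_mem hb)
    simp only [map_add] at this
    simp only [SetLike.mem_coe, AddSubgroup.mem_comap, map_sub, Φ, FreeAbelianGroup.lift_apply_of]
    convert this using 1
    abel
  have image (y : FreeAbelianGroup S) : Φ (FreeAbelianGroup.map Subtype.val y) ∈ H := by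
    induction y using FreeAbelianGroup.induction_on with
    | zero => simp
    | of Y =>
      simp only [FreeAbelianGroup.map_of_apply, Φ, FreeAbelianGroup.lift_apply_of]
      exact of_mem ((isoClass_mem_iff h hd).2 Y.2)
    | neg Y ih => simpa using ih
    | add x y hx hy => rw [map_add, map_add]; exact H.add_mem hx hy
  obtain ⟨y, hy⟩ := hX
  obtain ⟨y, rfl⟩ := QuotientAddGroup.mk_surjective y
  have hy' := H.add_mem (image y) (euler (QuotientAddGroup.eq.1 hy))
  rw [← map_add, add_neg_cancel_left, FreeAbelianGroup.lift_apply_of] at hy'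
  exact (isoClass_mem_iff h hd).1 (mem_of_of_mem_closure N
    (mem_of_add_mem_isoClassSubmonoid h hd) (exists_add_mem_isoClassSubmonoid h hd) hy')

lemma cls_biprod (X Y : C) : cls C (X ⊞ Y) = cls C X + cls C Y := by
  have : (FreeAbelianGroup.of (X ⊞ Y) - FreeAbelianGroup.of X - FreeAbelianGroup.of Y) ∈
      eulerSubgroup C :=
    AddSubgroup.subset_closure ⟨_, binaryBiproductTriangle_distinguished X Y, rfl⟩
  rw [sub_sub] at this
  exact ((QuotientAddGroup.eq_iff_sub_mem).2 this)

lemma cls_npowAux (X : C) (n : ℕ) : cls C (npowAux C X n) = (n + 1) • cls C X := by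
  induction n with
  | zero => simp [npowAux]
  | succ n ih => rw [npowAux, cls_biprod, ih, ← succ_nsmul']

lemma cls_npow (X : C) {n : ℕ} (hn : 1 ≤ n) : cls C (npow C X n) = n • cls C X := by
  rw [npow, cls_npowAux, Nat.sub_add_cancel hn]

lemma one_tmul_cls_mem_range {S : Set C} {X : C} (hX : X ∈ S) :
    (1 : ℚ) ⊗ₜ[ℤ] cls C X ∈ LinearMap.range (deltaQ C S) :=
  ⟨1 ⊗ₜ (QuotientAddGroup.mk (FreeAbelianGroup.of ⟨X, hX⟩) : GSub C S), rfl⟩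

/-- If `1 ⊗ b` lies in the image of `ℚ ⊗ f`, then a positive multiple of `b` lies in the
image of `f`. -/
lemma exists_nsmul_mem_range {A B : Type*} [AddCommGroup A] [AddCommGroup B] (f : A →ₗ[ℤ] B)
    {b : B} (hb : (1 : ℚ) ⊗ₜ[ℤ] b ∈ LinearMap.range (f.baseChange ℚ)) :
    ∃ n : ℕ, 1 ≤ n ∧ n • b ∈ LinearMap.range f := by
  have h0 : TensorProduct.mk ℤ ℚ (B ⧸ LinearMap.range f) 1 ((LinearMap.range f).mkQ b) = 0 := by
    obtain ⟨x, hx⟩ := hb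
    have := congrArg ((LinearMap.range f).mkQ.baseChange ℚ) hx
    rw [← LinearMap.comp_apply, ← LinearMap.baseChange_comp, LinearMap.range_mkQ_comp] at this
    simpa using this.symm
  obtain ⟨⟨s, hs⟩, hsb⟩ := (IsLocalizedModule.eq_zero_iff (nonZeroDivisors ℤ) _).1 h0
  have hsb : s • b ∈ LinearMap.range f := by
    rw [← Submodule.Quotient.mk_eq_zero]
    exact hsb
  have hs : s ≠ 0 := nonZeroDivisors.ne_zero hs
  refine ⟨s.natAbs, Int.natAbs_pos.2 hs, ?_⟩
  rw [← natCast_zsmul]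
  rcases s.natAbs_eq with e | e
  · rwa [← e]
  · rw [e, neg_smul, neg_mem_iff] at hsb
    exact hsb

lemma mem_iff_one_tmul_cls_mem_range {S : Set C} (h : IsTriangulatedSubcat C S)
    (hd : DenseSub C S) (hr : RadicalSub C S) (X : C) :
    X ∈ S ↔ (1 : ℚ) ⊗ₜ[ℤ] cls C X ∈ LinearMap.range (deltaQ C S) := by
  refine ⟨one_tmul_cls_mem_range, fun hX => ?_⟩
  obtain ⟨n, hn, y, hy⟩ := exists_nsmul_mem_range _ hX
  exact hr X n hn (mem_of_cls_mem_range h hd ⟨y, by rw [cls_npow X hn]; exact hy⟩)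

lemma deltaHom_comp_inclHom {S S' : Set C} (h : S ⊆ S') :
    (deltaHom C S').comp (inclHom C h) = deltaHom C S := by
  apply QuotientAddGroup.addMonoidHom_ext
  ext X
  rfl

lemma range_deltaQ_mono {S S' : Set C} (h : S ⊆ S') :
    LinearMap.range (deltaQ C S) ≤ LinearMap.range (deltaQ C S') := by
  have : deltaQ C S = deltaQ C S' ∘ₗ inclQ C h := by
    rw [deltaQ, deltaQ, inclQ, ← LinearMap.baseChange_comp, ← deltaHom_comp_inclHom h]
    rfl
  rw [this]
  exact LinearMap.range_comp_le_range _ _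

end

/-- for radical dense subcategories `D_{H₁}`, `D_{H₂}` corresponding to
`ℚ`-subspaces `H₁`, `H₂` of `G(C)_ℚ`, one has `D_{H₁} ⊆ D_{H₂}` iff `H₁ ⊆ H₂`. -/
theorem radical_dense_subcategory_subset_iff (H₁ H₂ : Submodule ℚ (ℚ ⊗[ℤ] G C))
    (S₁ S₂ : Set C)
    (h₁ : IsTriangulatedSubcat C S₁) (hd₁ : DenseSub C S₁) (hr₁ : RadicalSub C S₁)
    (h₂ : IsTriangulatedSubcat C S₂) (hd₂ : DenseSub C S₂) (hr₂ : RadicalSub C S₂)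
    (hH₁ : LinearMap.range (deltaQ C S₁) = H₁)
    (hH₂ : LinearMap.range (deltaQ C S₂) = H₂) :
    S₁ ⊆ S₂ ↔ H₁ ≤ H₂ := by
  subst hH₁ hH₂
  refine ⟨range_deltaQ_mono, fun hle X hX => ?_⟩
  exact (mem_iff_one_tmul_cls_mem_range h₂ hd₂ hr₂ X).2 (hle (one_tmul_cls_mem_range hX))


end GrothendieckPaper
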